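/- Let 1 < p < ∞, let γ, ν, a ∈ ℝ and let k ∈ ℕ₀. Then there exist constants 0 < c ≤ C < ∞, independent of u, such that for every smooth function u : 𝒟 → ℂ, writing v(z, φ) = e^{a z} u(e^{z} cos φ, e^{z} sin φ), one has (with all integrals and sums taken in [0, ∞]): c · Σ_{|α| ≤ k} ( ∫_{ℝ × (0,κ)} |∂_z^{α₁} ∂_φ^{α₂} v(z, φ)|^p · e^{(ν+2−(k+a)p) z} · min(φ, κ−φ)^{γ} dz dφ )^{1/p} ≤ Σ_{|α| ≤ k} ( ∫_𝒟 |∂^α u(x)|^p · w_{γ, ν+(|α|−k)p}(x) dx )^{1/p} ≤ C · Σ_{|α| ≤ k} ( ∫_{ℝ × (0,κ)} |∂_z^{α₁} ∂_φ^{α₂} v(z, φ)|^p · e^{(ν+2−(k+a)p) z} · min(φ, κ−φ)^{γ} dz dφ )^{1/p}. -/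

import Mathlib

open MeasureTheory Set Real
open scoped ENNReal

noncomputable section

/-- The planar angular domain with opening angle `κ`, as a subset of `ℝ × ℝ`. -/
def D2 (κ : ℝ) : Set (ℝ × ℝ) :=
  {x | ∃ r φ : ℝ, 0 < r ∧ 0 < φ ∧ φ < κ ∧ x = (r * Real.cos φ, r * Real.sin φ)}

/-- Partial derivative in the first variable. -/
def pd1 (f : ℝ × ℝ → ℂ) : ℝ × ℝ → ℂ := fun x => deriv (fun s => f (s, x.2)) x.1

/-- Partial derivative in the second variable. -/
def pd2 (f : ℝ × ℝ → ℂ) : ℝ × ℝ → ℂ := fun x => deriv (fun s => f (x.1, s)) x.2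

/-- Iterated partial derivative `∂_{x₁}^{α₁} ∂_{x₂}^{α₂} f` for a multi-index `α`. -/
def pdMix (α : ℕ × ℕ) (f : ℝ × ℝ → ℂ) : ℝ × ℝ → ℂ := pd1^[α.1] (pd2^[α.2] f)

/-- The Euler-coordinate parametrization `(z, φ) ↦ (eᶻ cos φ, eᶻ sin φ)`. -/
def eulerMap (p : ℝ × ℝ) : ℝ × ℝ := (Real.exp p.1 * Real.cos p.2, Real.exp p.1 * Real.sin p.2)

/-- The strip `ℝ × (0, κ)`. -/
def strip (κ : ℝ) : Set (ℝ × ℝ) := {p | 0 < p.2 ∧ p.2 < κ}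

/-- Euclidean norm on `ℝ × ℝ`. -/
def enorm2 (x : ℝ × ℝ) : ℝ := Real.sqrt (x.1 ^ 2 + x.2 ^ 2)

/-- Euclidean distance from `x` to the boundary of `𝒟`. -/
def rhoD2 (κ : ℝ) (x : ℝ × ℝ) : ℝ :=
  sInf ((fun y => enorm2 (x - y)) '' frontier (D2 κ))

/-- The mixed power weight `w_{γ,ν}(x) = ρ_∘(x)^{ν-γ} ρ_𝒟(x)^γ`. -/
def wgt2 (κ γ ν : ℝ) (x : ℝ × ℝ) : ℝ := enorm2 x ^ (ν - γ) * rhoD2 κ x ^ γ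

/-- The multi-indices `α ∈ ℕ₀²` with `|α| ≤ k`, as a finset. -/
def idx (k : ℕ) : Finset (ℕ × ℕ) :=
  Finset.filter (fun α : ℕ × ℕ => α.1 + α.2 ≤ k)
    (Finset.range (k + 1) ×ˢ Finset.range (k + 1))

/-- `v(z,φ) = e^{az} u(eᶻ cos φ, eᶻ sin φ)`. -/
def eulerPull (a : ℝ) (u : ℝ × ℝ → ℂ) : ℝ × ℝ → ℂ :=
  fun p => (Real.exp (a * p.1) : ℂ) * u (eulerMap p)


lemma pd1_eq {S : Set (ℝ × ℝ)} (hS : IsOpen S) {f : ℝ × ℝ → ℂ} (hf : DifferentiableOn ℝ f S)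
    {x : ℝ × ℝ} (hx : x ∈ S) : pd1 f x = fderiv ℝ f x (1, 0) := by
  have h := (hf.differentiableAt (hS.mem_nhds hx)).hasFDerivAt
  have h2 : HasDerivAt (fun s : ℝ => (s, x.2)) ((1 : ℝ), (0 : ℝ)) x.1 :=
    (hasDerivAt_id x.1).prodMk (hasDerivAt_const x.1 x.2)
  exact (HasFDerivAt.comp_hasDerivAt (f := fun s : ℝ => (s, x.2)) x.1 h h2).deriv

lemma pd2_eq {S : Set (ℝ × ℝ)} (hS : IsOpen S) {f : ℝ × ℝ → ℂ} (hf : DifferentiableOn ℝ f S)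
    {x : ℝ × ℝ} (hx : x ∈ S) : pd2 f x = fderiv ℝ f x (0, 1) := by
  have h := (hf.differentiableAt (hS.mem_nhds hx)).hasFDerivAt
  have h2 : HasDerivAt (fun s : ℝ => (x.1, s)) ((0 : ℝ), (1 : ℝ)) x.2 :=
    (hasDerivAt_const x.2 x.1).prodMk (hasDerivAt_id x.2)
  exact (HasFDerivAt.comp_hasDerivAt (f := fun s : ℝ => (x.1, s)) x.2 h h2).deriv

abbrev Sm (S : Set (ℝ × ℝ)) (f : ℝ × ℝ → ℂ) : Prop := ContDiffOn ℝ (⊤ : ℕ∞) f S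

lemma Sm.diff {S : Set (ℝ × ℝ)} {f : ℝ × ℝ → ℂ} (h : Sm S f) : DifferentiableOn ℝ f S :=
  ContDiffOn.differentiableOn h (by simp)

lemma Sm.fd {S : Set (ℝ × ℝ)} (hS : IsOpen S) {f : ℝ × ℝ → ℂ} (h : Sm S f) (v : ℝ × ℝ) :
    Sm S (fun x => fderiv ℝ f x v) :=
  (ContDiffOn.fderiv_of_isOpen h hS (m := (⊤ : ℕ∞)) (by simp)).clm_apply contDiffOn_const

lemma Sm.pd1 {S : Set (ℝ × ℝ)} (hS : IsOpen S) {f : ℝ × ℝ → ℂ} (h : Sm S f) : Sm S (pd1 f) :=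
  (h.fd hS (1, 0)).congr (fun _ hx => pd1_eq hS h.diff hx)

lemma Sm.pd2 {S : Set (ℝ × ℝ)} (hS : IsOpen S) {f : ℝ × ℝ → ℂ} (h : Sm S f) : Sm S (pd2 f) :=
  (h.fd hS (0, 1)).congr (fun _ hx => pd2_eq hS h.diff hx)

lemma pd1_congr {S : Set (ℝ × ℝ)} (hS : IsOpen S) {f g : ℝ × ℝ → ℂ} (h : EqOn f g S) :
    EqOn (pd1 f) (pd1 g) S := by
  intro x hx
  apply Filter.EventuallyEq.deriv_eq
  have hc : ContinuousAt (fun s : ℝ => (s, x.2)) x.1 := by fun_prop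
  filter_upwards [hc.preimage_mem_nhds (hS.mem_nhds hx)] with s hs using h hs

lemma pd2_congr {S : Set (ℝ × ℝ)} (hS : IsOpen S) {f g : ℝ × ℝ → ℂ} (h : EqOn f g S) :
    EqOn (pd2 f) (pd2 g) S := by
  intro x hx
  apply Filter.EventuallyEq.deriv_eq
  have hc : ContinuousAt (fun s : ℝ => (x.1, s)) x.2 := by fun_prop
  filter_upwards [hc.preimage_mem_nhds (hS.mem_nhds hx)] with s hs using h hs

lemma pd_comm {S : Set (ℝ × ℝ)} (hS : IsOpen S) {f : ℝ × ℝ → ℂ} (h : Sm S f) :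
    EqOn (pd2 (pd1 f)) (pd1 (pd2 f)) S := by
  intro x hx
  have e1 : EqOn (pd1 f) (fun x => fderiv ℝ f x (1, 0)) S := fun _ hx => pd1_eq hS h.diff hx
  have e2 : EqOn (pd2 f) (fun x => fderiv ℝ f x (0, 1)) S := fun _ hx => pd2_eq hS h.diff hx
  rw [pd2_congr hS e1 hx, pd1_congr hS e2 hx, pd2_eq hS (h.fd hS _).diff hx,
    pd1_eq hS (h.fd hS _).diff hx]
  have hd : DifferentiableAt ℝ (fderiv ℝ f) x :=
    ((ContDiffOn.fderiv_of_isOpen h hS (m := (⊤ : ℕ∞)) (by simp)).differentiableOn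
      (by simp)).differentiableAt (hS.mem_nhds hx)
  rw [fderiv_clm_apply hd (by fun_prop), fderiv_clm_apply hd (by fun_prop)]
  have hs : IsSymmSndFDerivAt ℝ f x :=
    (ContDiffOn.contDiffAt h (hS.mem_nhds hx)).isSymmSndFDerivAt
      (by simp only [minSmoothness_of_isRCLikeNormedField]; exact WithTop.coe_le_coe.2 le_top)
  simpa using hs.eq (0, 1) (1, 0)

lemma Sm.pd1_iter {S : Set (ℝ × ℝ)} (hS : IsOpen S) {f : ℝ × ℝ → ℂ} (h : Sm S f) (n : ℕ) :
    Sm S (_root_.pd1^[n] f) := by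
  induction n with
  | zero => exact h
  | succ n ih => rw [Function.iterate_succ_apply']; exact ih.pd1 hS

lemma Sm.pd2_iter {S : Set (ℝ × ℝ)} (hS : IsOpen S) {f : ℝ × ℝ → ℂ} (h : Sm S f) (n : ℕ) :
    Sm S (_root_.pd2^[n] f) := by
  induction n with
  | zero => exact h
  | succ n ih => rw [Function.iterate_succ_apply']; exact ih.pd2 hS

lemma Sm.mix {S : Set (ℝ × ℝ)} (hS : IsOpen S) {f : ℝ × ℝ → ℂ} (h : Sm S f) (α : ℕ × ℕ) :
    Sm S (pdMix α f) := (h.pd2_iter hS _).pd1_iter hS _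

lemma pd1_mix (α : ℕ × ℕ) (f : ℝ × ℝ → ℂ) : pd1 (pdMix α f) = pdMix (α.1 + 1, α.2) f := by
  simp only [pdMix, Function.iterate_succ_apply']

lemma pd2_mix {S : Set (ℝ × ℝ)} (hS : IsOpen S) {f : ℝ × ℝ → ℂ} (h : Sm S f) (α : ℕ × ℕ) :
    EqOn (pd2 (pdMix α f)) (pdMix (α.1, α.2 + 1) f) S := by
  obtain ⟨n, m⟩ := α
  simp only [pdMix, Function.iterate_succ_apply' pd2 m]
  have hg : Sm S (pd2^[m] f) := h.pd2_iter hS m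
  generalize pd2^[m] f = g at hg
  induction n with
  | zero => intro x _; rfl
  | succ n ih =>
    simp only [Function.iterate_succ_apply']
    intro x hx
    rw [pd_comm hS (hg.pd1_iter hS n) hx, pd1_congr hS ih hx]

inductive Sp {ι : Type} (S : Set (ℝ × ℝ)) (X : ℕ × ℕ → ι → ℝ × ℝ → ℂ) :
    ℕ → (ι → ℝ × ℝ → ℂ) → Prop
  | base (β : ℕ × ℕ) (m : ℕ) (h : β.1 + β.2 ≤ m) : Sp S X m (X β)
  | plus (m : ℕ) (T T' : ι → ℝ × ℝ → ℂ) : Sp S X m T → Sp S X m T' →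
      Sp S X m (fun i q => T i q + T' i q)
  | smul (m : ℕ) (c : ℂ) (T : ι → ℝ × ℝ → ℂ) : Sp S X m T → Sp S X m (fun i q => c * T i q)
  | sin (m : ℕ) (T : ι → ℝ × ℝ → ℂ) : Sp S X m T →
      Sp S X m (fun i q => (Real.sin q.2 : ℂ) * T i q)
  | cos (m : ℕ) (T : ι → ℝ × ℝ → ℂ) : Sp S X m T →
      Sp S X m (fun i q => (Real.cos q.2 : ℂ) * T i q)
  | congr (m : ℕ) (T T' : ι → ℝ × ℝ → ℂ) : Sp S X m T → (∀ i, EqOn (T' i) (T i) S) →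
      Sp S X m T'

section
variable {ι : Type} {S : Set (ℝ × ℝ)} {X : ℕ × ℕ → ι → ℝ × ℝ → ℂ}

lemma Sp.mono {m m' : ℕ} (hm : m ≤ m') {T : ι → ℝ × ℝ → ℂ} (h : Sp S X m T) : Sp S X m' T := by
  induction h with
  | base β m h => exact .base _ _ (h.trans hm)
  | plus m T T' _ _ h1 h2 => exact .plus _ _ _ (h1 hm) (h2 hm)
  | smul m c T _ h => exact .smul _ _ _ (h hm)
  | sin m T _ h => exact .sin _ _ (h hm)
  | cos m T _ h => exact .cos _ _ (h hm)
  | congr m T T' _ e h => exact .congr _ _ _ (h hm) e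

lemma sm_sin : Sm S (fun q => (Real.sin q.2 : ℂ)) :=
  (Complex.ofRealCLM.contDiff.comp (Real.contDiff_sin.comp contDiff_snd)).contDiffOn
lemma sm_cos : Sm S (fun q => (Real.cos q.2 : ℂ)) :=
  (Complex.ofRealCLM.contDiff.comp (Real.contDiff_cos.comp contDiff_snd)).contDiffOn

lemma Sp.sm (hX : ∀ β i, Sm S (X β i)) {m : ℕ} {T : ι → ℝ × ℝ → ℂ} (h : Sp S X m T) (i : ι) :
    Sm S (T i) := by
  induction h with
  | base β m h => exact hX _ _
  | plus m T T' _ _ h1 h2 => exact ContDiffOn.add h1 h2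
  | smul m c T _ h => exact ContDiffOn.mul contDiffOn_const h
  | sin m T _ h => exact ContDiffOn.mul sm_sin h
  | cos m T _ h => exact ContDiffOn.mul sm_cos h
  | congr m T T' _ e h => exact ContDiffOn.congr h (e i)

lemma Sm.d1 (hS : IsOpen S) {f : ℝ × ℝ → ℂ} (h : Sm S f) {x : ℝ × ℝ} (hx : x ∈ S) :
    HasDerivAt (fun s => f (s, x.2)) (_root_.pd1 f x) x.1 := by
  have hd := (h.diff.differentiableAt (hS.mem_nhds hx))
  have h2 : DifferentiableAt ℝ (fun s : ℝ => (s, x.2)) x.1 := by fun_prop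
  exact (DifferentiableAt.comp (f := fun s : ℝ => (s, x.2)) x.1 hd h2).hasDerivAt

lemma Sm.d2 (hS : IsOpen S) {f : ℝ × ℝ → ℂ} (h : Sm S f) {x : ℝ × ℝ} (hx : x ∈ S) :
    HasDerivAt (fun s => f (x.1, s)) (_root_.pd2 f x) x.2 := by
  have hd := (h.diff.differentiableAt (hS.mem_nhds hx))
  have h2 : DifferentiableAt ℝ (fun s : ℝ => (x.1, s)) x.2 := by fun_prop
  exact (DifferentiableAt.comp (f := fun s : ℝ => (x.1, s)) x.2 hd h2).hasDerivAt

lemma Sp.pd (hS : IsOpen S) (hX : ∀ β i, Sm S (X β i))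
    (h1 : ∀ β, Sp S X (β.1 + β.2 + 1) (fun i => pd1 (X β i)))
    (h2 : ∀ β, Sp S X (β.1 + β.2 + 1) (fun i => pd2 (X β i)))
    {m : ℕ} {T : ι → ℝ × ℝ → ℂ} (h : Sp S X m T) :
    Sp S X (m + 1) (fun i => pd1 (T i)) ∧ Sp S X (m + 1) (fun i => pd2 (T i)) := by
  induction h with
  | base β m h => exact ⟨(h1 β).mono (by omega), (h2 β).mono (by omega)⟩
  | plus m T T' a b h1 h2 =>
    refine ⟨.congr _ _ _ (.plus _ _ _ h1.1 h2.1) fun i q hq => ?_,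
      .congr _ _ _ (.plus _ _ _ h1.2 h2.2) fun i q hq => ?_⟩
    · exact ((a.sm hX i).d1 hS hq |>.add ((b.sm hX i).d1 hS hq)).deriv
    · exact ((a.sm hX i).d2 hS hq |>.add ((b.sm hX i).d2 hS hq)).deriv
  | smul m c T a h =>
    refine ⟨.congr _ _ _ (.smul _ c _ h.1) fun i q hq => ?_,
      .congr _ _ _ (.smul _ c _ h.2) fun i q hq => ?_⟩
    · exact (((a.sm hX i).d1 hS hq).const_mul c).deriv
    · exact (((a.sm hX i).d2 hS hq).const_mul c).deriv
  | sin m T a h =>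
    refine ⟨.congr _ _ _ (.sin _ _ h.1) fun i q hq => ?_,
      .congr _ _ _ (.plus _ _ _ (.cos _ _ (a.mono (Nat.le_succ m))) (.sin _ _ h.2))
        fun i q hq => ?_⟩
    · exact (((a.sm hX i).d1 hS hq).const_mul (Real.sin q.2 : ℂ)).deriv
    · exact ((Real.hasDerivAt_sin q.2).ofReal_comp.mul ((a.sm hX i).d2 hS hq)).deriv
  | cos m T a h =>
    refine ⟨.congr _ _ _ (.cos _ _ h.1) fun i q hq => ?_,
      .congr _ _ _ (.plus _ _ _ (.smul _ (-1) _ (.sin _ _ (a.mono (Nat.le_succ m)))) (.cos _ _ h.2))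
        fun i q hq => ?_⟩
    · exact (((a.sm hX i).d1 hS hq).const_mul (Real.cos q.2 : ℂ)).deriv
    · refine ((Real.hasDerivAt_cos q.2).ofReal_comp.mul ((a.sm hX i).d2 hS hq)).deriv.trans ?_
      push_cast; ring
  | congr m T T' a e h =>
    exact ⟨.congr _ _ _ h.1 fun i => pd1_congr hS (e i), .congr _ _ _ h.2 fun i => pd2_congr hS (e i)⟩

lemma mem_idx {k : ℕ} {α : ℕ × ℕ} : α ∈ idx k ↔ α.1 + α.2 ≤ k := by
  simp only [idx, Finset.mem_filter, Finset.mem_product, Finset.mem_range]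
  omega

lemma Sp.bound {m : ℕ} {T : ι → ℝ × ℝ → ℂ} (h : Sp S X m T) :
    ∃ M : ℝ, 0 ≤ M ∧ ∀ i, ∀ q ∈ S, ‖T i q‖ ≤ M * ∑ β ∈ idx m, ‖X β i q‖ := by
  induction h with
  | base β m h =>
    refine ⟨1, zero_le_one, fun i q _ => ?_⟩
    rw [one_mul]
    exact Finset.single_le_sum (f := fun β => ‖X β i q‖) (fun _ _ => norm_nonneg _) (mem_idx.2 h)
  | plus m T T' a b h1 h2 =>
    obtain ⟨M, hM, h⟩ := h1
    obtain ⟨M', hM', h'⟩ := h2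
    refine ⟨M + M', by positivity, fun i q hq => (norm_add_le _ _).trans ?_⟩
    rw [add_mul]; exact add_le_add (h i q hq) (h' i q hq)
  | smul m c T a h =>
    obtain ⟨M, hM, h⟩ := h
    refine ⟨‖c‖ * M, by positivity, fun i q hq => ?_⟩
    rw [norm_mul, mul_assoc]
    exact mul_le_mul_of_nonneg_left (h i q hq) (norm_nonneg _)
  | sin m T a h =>
    obtain ⟨M, hM, h⟩ := h
    refine ⟨M, hM, fun i q hq => ?_⟩
    rw [norm_mul, Complex.norm_real]
    exact (mul_le_of_le_one_left (norm_nonneg _) (Real.abs_sin_le_one _)).trans (h i q hq)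
  | cos m T a h =>
    obtain ⟨M, hM, h⟩ := h
    refine ⟨M, hM, fun i q hq => ?_⟩
    rw [norm_mul, Complex.norm_real]
    exact (mul_le_of_le_one_left (norm_nonneg _) (Real.abs_cos_le_one _)).trans (h i q hq)
  | congr m T T' a e h =>
    obtain ⟨M, hM, h⟩ := h
    refine ⟨M, hM, fun i q hq => ?_⟩
    rw [e i hq]; exact h i q hq

end

def eulerD (q : ℝ × ℝ) : ℝ × ℝ →L[ℝ] ℝ × ℝ :=
  (Matrix.toLin (.finTwoProd ℝ) (.finTwoProd ℝ)
    !![Real.exp q.1 * Real.cos q.2, -(Real.exp q.1 * Real.sin q.2);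
      Real.exp q.1 * Real.sin q.2, Real.exp q.1 * Real.cos q.2]).toContinuousLinearMap

lemma hasFDerivAt_euler (q : ℝ × ℝ) : HasFDerivAt eulerMap (eulerD q) q := by
  unfold eulerD
  rw [Matrix.toLin_finTwoProd_toContinuousLinearMap]
  have he := (Real.hasDerivAt_exp q.1).comp_hasFDerivAt q (hasFDerivAt_fst (𝕜 := ℝ))
  convert!
    HasFDerivAt.prodMk (𝕜 := ℝ)
      (he.mul ((Real.hasDerivAt_cos q.2).comp_hasFDerivAt q hasFDerivAt_snd))
      (he.mul ((Real.hasDerivAt_sin q.2).comp_hasFDerivAt q hasFDerivAt_snd)) using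
    2 <;>
  · ext <;> simp <;> ring

lemma det_eulerD (q : ℝ × ℝ) : (eulerD q).det = Real.exp q.1 * Real.exp q.1 := by
  conv_rhs => rw [← one_mul (Real.exp q.1 * Real.exp q.1), ← Real.cos_sq_add_sin_sq q.2]
  unfold eulerD
  simp only [LinearMap.det_toContinuousLinearMap, LinearMap.det_toLin,
    Matrix.det_fin_two_of, sub_neg_eq_add]
  ring

lemma contDiff_euler : ContDiff ℝ (⊤ : ℕ∞) eulerMap := by
  unfold eulerMap
  fun_prop

lemma euler_nhds (q : ℝ × ℝ) : Filter.map eulerMap (nhds q) = nhds (eulerMap q) := by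
  have hd : (eulerD q).det ≠ 0 := by rw [det_eulerD]; positivity
  have h : HasStrictFDerivAt eulerMap
      (((eulerD q).toContinuousLinearEquivOfDetNeZero hd : (ℝ × ℝ) ≃L[ℝ] (ℝ × ℝ)) :
        (ℝ × ℝ) →L[ℝ] (ℝ × ℝ)) q :=
    contDiff_euler.contDiffAt.hasStrictFDerivAt' (hasFDerivAt_euler q) (by simp)
  exact h.map_nhds_eq_of_equiv

lemma D2_eq (κ : ℝ) : D2 κ = eulerMap '' strip κ := by
  ext x
  constructor
  · rintro ⟨r, φ, hr, h0, h1, rfl⟩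
    exact ⟨(Real.log r, φ), ⟨h0, h1⟩, by simp [eulerMap, Real.exp_log hr]⟩
  · rintro ⟨q, ⟨h0, h1⟩, rfl⟩
    exact ⟨Real.exp q.1, q.2, Real.exp_pos _, h0, h1, rfl⟩

lemma strip_open (κ : ℝ) : IsOpen (strip κ) :=
  (isOpen_lt continuous_const continuous_snd).inter (isOpen_lt continuous_snd continuous_const)

lemma D2_open (κ : ℝ) : IsOpen (D2 κ) := by
  rw [D2_eq]
  exact (isOpenMap_iff_nhds_le.2 fun q => (euler_nhds q).ge) _ (strip_open κ)

lemma euler_mem {κ : ℝ} {q : ℝ × ℝ} (hq : q ∈ strip κ) : eulerMap q ∈ D2 κ := by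
  rw [D2_eq]; exact mem_image_of_mem _ hq

lemma polar_inj {r s φ θ : ℝ} (hr : 0 < r) (hs : 0 < s) (h1 : r * Real.cos φ = s * Real.cos θ)
    (h2 : r * Real.sin φ = s * Real.sin θ) (l : -(2 * π) < φ - θ) (l' : φ - θ < 2 * π) :
    r = s ∧ φ = θ := by
  have e1 := Real.sin_sq_add_cos_sq φ
  have e2 := Real.sin_sq_add_cos_sq θ
  have hrs : r ^ 2 = s ^ 2 := by
    calc r ^ 2 = (r * Real.cos φ) ^ 2 + (r * Real.sin φ) ^ 2 := by linear_combination (-r^2) * e1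
      _ = (s * Real.cos θ) ^ 2 + (s * Real.sin θ) ^ 2 := by rw [h1, h2]
      _ = s ^ 2 := by linear_combination (s^2) * e2
  have hrs' : r = s := by nlinarith
  subst hrs'
  have c := mul_left_cancel₀ hr.ne' h1
  have d := mul_left_cancel₀ hr.ne' h2
  have : Real.cos (φ - θ) = 1 := by rw [Real.cos_sub, c, d]; linarith
  rw [Real.cos_eq_one_iff_of_lt_of_lt l l'] at this
  exact ⟨rfl, by linarith⟩

lemma euler_inj {κ : ℝ} (hκ' : κ < 2 * π) : InjOn eulerMap (strip κ) := by
  rintro ⟨z, φ⟩ ⟨h0, h1⟩ ⟨w, θ⟩ ⟨h2, h3⟩ h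
  simp only [eulerMap, Prod.mk.injEq] at h h0 h1 h2 h3
  obtain ⟨a, b⟩ := polar_inj (Real.exp_pos z) (Real.exp_pos w) h.1 h.2 (by linarith) (by linarith)
  rw [Real.exp_injective a, b]

lemma exists_polar (y : ℝ × ℝ) (hy : y ≠ 0) : ∃ r θ : ℝ, 0 < r ∧ 0 < θ ∧ θ ≤ 2 * π ∧
    y = (r * Real.cos θ, r * Real.sin θ) := by
  set c : ℂ := ⟨y.1, y.2⟩ with hc
  have hc0 : c ≠ 0 := by
    intro h
    apply hy
    have h1 := congrArg Complex.re h
    have h2 := congrArg Complex.im h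
    exact Prod.ext h1 h2
  have h1 := Complex.norm_mul_cos_arg c
  have h2 := Complex.norm_mul_sin_arg c
  have l1 := Complex.neg_pi_lt_arg c
  have l2 := Complex.arg_le_pi c
  have := Real.pi_pos
  by_cases hp : 0 < c.arg
  · exact ⟨‖c‖, c.arg, by positivity, hp, by linarith, by ext <;> simp [h1, h2, hc]⟩
  · exact ⟨‖c‖, c.arg + 2 * π, by positivity, by linarith, by linarith,
      by ext <;> simp [h1, h2, hc]⟩

lemma D2_out {κ : ℝ} {q y : ℝ × ℝ} (hq : q ∈ strip κ) (hκ' : κ < 2 * π)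
    (hy : y ∉ D2 κ) : Real.exp q.1 * min q.2 (κ - q.2) / π ≤ enorm2 (eulerMap q - y) := by
  obtain ⟨z, φ⟩ := q
  obtain ⟨h0, h1⟩ := hq
  simp only at h0 h1 ⊢
  set m := min φ (κ - φ) with hm
  have m1 : m ≤ φ := min_le_left _ _
  have m2 : m ≤ κ - φ := min_le_right _ _
  have m0 : 0 < m := lt_min h0 (by linarith)
  have hpi := Real.pi_pos
  have mpi : m ≤ π := by linarith
  have hR := Real.exp_pos z
  set R := Real.exp z with hRdef
  unfold enorm2
  apply Real.le_sqrt_of_sq_le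
  have hsq := Real.sin_sq_add_cos_sq φ
  have hs := Real.mul_le_sin (x := m / 2) (by linarith) (by linarith)
  have hs' : (m / π) ^ 2 ≤ (1 - Real.cos m) / 2 := by
    have e : Real.sin (m / 2) ^ 2 = (1 - Real.cos m) / 2 := by
      have := Real.cos_sq (m / 2)
      rw [show 2 * (m / 2) = m by ring] at this
      have := Real.sin_sq_add_cos_sq (m / 2)
      linarith
    rw [← e]
    have : 2 / π * (m / 2) = m / π := by ring
    rw [this] at hs
    exact pow_le_pow_left₀ (by positivity) hs 2
  have key : R ^ 2 * ((1 - Real.cos m) / 2) ≤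
      (eulerMap (z, φ) - y).1 ^ 2 + (eulerMap (z, φ) - y).2 ^ 2 := by
    have hcm := Real.neg_one_le_cos m
    have hcm' := Real.cos_le_one m
    by_cases hy0 : y = 0
    · subst hy0
      simp only [eulerMap, sub_zero]
      have : (R * Real.cos φ) ^ 2 + (R * Real.sin φ) ^ 2 = R ^ 2 := by
        linear_combination R ^ 2 * hsq
      rw [← hRdef, this]
      nlinarith
    · obtain ⟨r, θ, hr, t0, t1, rfl⟩ := exists_polar y hy0
      have ht : κ ≤ θ := by
        by_contra hlt
        exact hy ⟨r, θ, hr, t0, not_le.1 hlt, rfl⟩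
      have hcos : Real.cos (θ - φ) ≤ Real.cos m := by
        by_cases hle : θ - φ ≤ π
        · exact Real.cos_le_cos_of_nonneg_of_le_pi m0.le hle (by linarith)
        · rw [← Real.cos_two_pi_sub (θ - φ)]
          exact Real.cos_le_cos_of_nonneg_of_le_pi m0.le (by linarith) (by linarith)
      have ex : (eulerMap (z, φ) - (r * Real.cos θ, r * Real.sin θ)).1 ^ 2
          + (eulerMap (z, φ) - (r * Real.cos θ, r * Real.sin θ)).2 ^ 2
          = R ^ 2 + r ^ 2 - 2 * R * r * Real.cos (θ - φ) := by
        simp only [eulerMap, Prod.fst_sub, Prod.snd_sub, ← hRdef]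
        rw [Real.cos_sub]
        linear_combination R ^ 2 * hsq + r ^ 2 * Real.sin_sq_add_cos_sq θ
      rw [ex]
      have hRr : 0 < R * r := by positivity
      have h3 : R * r * Real.cos (θ - φ) ≤ R * r * Real.cos m :=
        mul_le_mul_of_nonneg_left hcos hRr.le
      generalize Real.cos m = t at *
      have h4 : R ^ 2 * ((1 - t) / 2) ≤ R ^ 2 + r ^ 2 - 2 * R * r * t := by
        by_cases ht : 0 ≤ t
        · nlinarith [sq_nonneg (r - R * t), mul_nonneg (sq_nonneg R) (mul_nonneg (sub_nonneg.2 hcm') ht), mul_nonneg (sq_nonneg R) (sub_nonneg.2 hcm')]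
        · nlinarith [mul_pos hRr (neg_pos.2 (not_le.1 ht)), mul_nonneg (sq_nonneg R) (by linarith : (0:ℝ) ≤ 1 + t), sq_nonneg r]
      linarith
  calc (R * m / π) ^ 2 = R ^ 2 * (m / π) ^ 2 := by ring
    _ ≤ R ^ 2 * ((1 - Real.cos m) / 2) := mul_le_mul_of_nonneg_left hs' (sq_nonneg _)
    _ ≤ _ := key

lemma ray_frontier {κ r θ : ℝ} (hκ : 0 < κ) (hκ' : κ < 2 * π) (hr : 0 < r) (hθ : θ = 0 ∨ θ = κ) :
    (r * Real.cos θ, r * Real.sin θ) ∈ frontier (D2 κ) := by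
  rw [(D2_open κ).frontier_eq]
  constructor
  · have hc : Continuous (fun t : ℝ => (r * Real.cos t, r * Real.sin t)) := by fun_prop
    have hθ' : θ ∈ closure (Ioo 0 κ) := by
      rw [closure_Ioo hκ.ne]
      rcases hθ with rfl | rfl
      · exact ⟨le_rfl, hκ.le⟩
      · exact ⟨hκ.le, le_rfl⟩
    exact map_mem_closure (f := fun t : ℝ => (r * Real.cos t, r * Real.sin t)) hc hθ' fun t ht => ⟨r, t, hr, ht.1, ht.2, rfl⟩
  · rintro ⟨s, φ, hs, h0, h1, h⟩
    simp only [Prod.mk.injEq] at h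
    obtain ⟨_, e⟩ := polar_inj hr hs h.1 h.2 (by rcases hθ with rfl | rfl <;> linarith)
      (by rcases hθ with rfl | rfl <;> linarith)
    rcases hθ with rfl | rfl <;> linarith

lemma chord_le {R φ θ : ℝ} (hR : 0 < R) :
    enorm2 ((R * Real.cos φ, R * Real.sin φ) - (R * Real.cos θ, R * Real.sin θ)) ≤ R * |φ - θ| := by
  unfold enorm2
  apply Real.sqrt_le_iff.2 ⟨by positivity, ?_⟩
  rw [mul_pow, sq_abs]
  have h := Real.one_sub_sq_div_two_le_cos (x := φ - θ)
  rw [Real.cos_sub] at h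
  simp only [Prod.fst_sub, Prod.snd_sub]
  have e1 := Real.sin_sq_add_cos_sq φ
  have e2 := Real.sin_sq_add_cos_sq θ
  have : (R * Real.cos φ - R * Real.cos θ) ^ 2 + (R * Real.sin φ - R * Real.sin θ) ^ 2
    = R ^ 2 * (2 - 2 * (Real.cos φ * Real.cos θ + Real.sin φ * Real.sin θ)) := by
    linear_combination R ^ 2 * e1 + R ^ 2 * e2
  rw [this]
  exact mul_le_mul_of_nonneg_left (by linarith) (sq_nonneg _)

lemma rho_bounds {κ : ℝ} (hκ : 0 < κ) (hκ' : κ < 2 * π) {q : ℝ × ℝ} (hq : q ∈ strip κ) :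
    Real.exp q.1 * min q.2 (κ - q.2) / π ≤ rhoD2 κ (eulerMap q) ∧
      rhoD2 κ (eulerMap q) ≤ Real.exp q.1 * min q.2 (κ - q.2) := by
  have hb : BddBelow ((fun y => enorm2 (eulerMap q - y)) '' frontier (D2 κ)) :=
    ⟨0, by rintro _ ⟨y, _, rfl⟩; exact Real.sqrt_nonneg _⟩
  have hf : ∀ θ, (θ = 0 ∨ θ = κ) → rhoD2 κ (eulerMap q) ≤ Real.exp q.1 * |q.2 - θ| := fun θ hθ =>
    (csInf_le hb (mem_image_of_mem _ (ray_frontier hκ hκ' (Real.exp_pos q.1) hθ))).trans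
      (chord_le (Real.exp_pos _))
  refine ⟨?_, ?_⟩
  · apply le_csInf
    · exact ⟨_, mem_image_of_mem _ (ray_frontier hκ hκ' (Real.exp_pos q.1) (Or.inl rfl))⟩
    · rintro _ ⟨y, hy, rfl⟩
      rw [(D2_open κ).frontier_eq] at hy
      exact D2_out hq hκ' hy.2
  · have a := hf 0 (Or.inl rfl)
    have b := hf κ (Or.inr rfl)
    obtain ⟨h0, h1⟩ := hq
    rw [sub_zero, abs_of_pos h0] at a
    rw [abs_of_neg (by linarith), neg_sub] at b
    rcases min_choice q.2 (κ - q.2) with h | h <;> rw [h] <;> assumption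

lemma enorm2_euler (q : ℝ × ℝ) : enorm2 (eulerMap q) = Real.exp q.1 := by
  unfold enorm2 eulerMap
  rw [show (Real.exp q.1 * Real.cos q.2) ^ 2 + (Real.exp q.1 * Real.sin q.2) ^ 2
    = Real.exp q.1 ^ 2 by linear_combination (Real.exp q.1) ^ 2 * Real.sin_sq_add_cos_sq q.2]
  exact Real.sqrt_sq (Real.exp_pos _).le

lemma rpow_cmp {t m : ℝ} (γ : ℝ) (hm : 0 < m) (h1 : m / π ≤ t) (h2 : t ≤ m) :
    t ^ γ ≤ π ^ |γ| * m ^ γ ∧ m ^ γ ≤ π ^ |γ| * t ^ γ := by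
  have hpi := Real.pi_pos
  have hpi1 : 1 ≤ π := by linarith [Real.pi_gt_three]
  have ht : 0 < t := lt_of_lt_of_le (by positivity) h1
  have h3 : m ≤ π * t := by rw [div_le_iff₀ hpi] at h1; linarith
  have hP : 1 ≤ π ^ |γ| := Real.one_le_rpow hpi1 (abs_nonneg _)
  rcases le_total 0 γ with hg | hg
  · have a : t ^ γ ≤ m ^ γ := Real.rpow_le_rpow ht.le h2 hg
    have b : m ^ γ ≤ (π * t) ^ γ := Real.rpow_le_rpow hm.le h3 hg
    rw [Real.mul_rpow hpi.le ht.le] at b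
    have := Real.rpow_nonneg hm.le γ
    exact ⟨a.trans (by nlinarith), by rwa [abs_of_nonneg hg]⟩
  · have a : m ^ γ ≤ t ^ γ := Real.rpow_le_rpow_of_nonpos ht h2 hg
    have b : (π * t) ^ γ ≤ m ^ γ := Real.rpow_le_rpow_of_nonpos hm h3 hg
    rw [Real.mul_rpow hpi.le ht.le] at b
    have h5 := Real.rpow_nonneg ht.le γ
    have h6 := Real.rpow_pos_of_pos hpi γ
    refine ⟨?_, a.trans (by nlinarith)⟩
    rw [abs_of_nonpos hg, Real.rpow_neg hpi.le]
    rw [← div_eq_inv_mul, le_div_iff₀ h6]; linarith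

lemma fderiv_pair {f : ℝ × ℝ → ℂ} {x : ℝ × ℝ} (s t : ℝ) :
    fderiv ℝ f x (s, t) = s * fderiv ℝ f x (1, 0) + t * fderiv ℝ f x (0, 1) := by
  have : ((s, t) : ℝ × ℝ) = s • ((1 : ℝ), (0 : ℝ)) + t • ((0 : ℝ), (1 : ℝ)) := by simp
  rw [this, map_add, map_smul, map_smul]; simp

lemma chain1 {κ : ℝ} {f : ℝ × ℝ → ℂ} (h : Sm (D2 κ) f) {q : ℝ × ℝ} (hq : q ∈ strip κ) :
    HasDerivAt (fun s => f (eulerMap (s, q.2)))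
      ((Real.exp q.1 : ℂ) * (Real.cos q.2 * pd1 f (eulerMap q) + Real.sin q.2 * pd2 f (eulerMap q)))
      q.1 := by
  have hE := euler_mem hq
  have hd := (h.diff.differentiableAt ((D2_open κ).mem_nhds hE)).hasFDerivAt
  have h2 : HasDerivAt (fun s : ℝ => eulerMap (s, q.2))
      (Real.exp q.1 * Real.cos q.2, Real.exp q.1 * Real.sin q.2) q.1 :=
    ((Real.hasDerivAt_exp q.1).mul_const (Real.cos q.2)).prodMk
      ((Real.hasDerivAt_exp q.1).mul_const (Real.sin q.2))
  have h3 := HasFDerivAt.comp_hasDerivAt (f := fun s : ℝ => eulerMap (s, q.2)) q.1 hd h2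
  rw [fderiv_pair, ← pd1_eq (D2_open κ) h.diff hE, ← pd2_eq (D2_open κ) h.diff hE] at h3
  convert! h3 using 1
  push_cast; ring

lemma chain2 {κ : ℝ} {f : ℝ × ℝ → ℂ} (h : Sm (D2 κ) f) {q : ℝ × ℝ} (hq : q ∈ strip κ) :
    HasDerivAt (fun s => f (eulerMap (q.1, s)))
      ((Real.exp q.1 : ℂ) * (-Real.sin q.2 * pd1 f (eulerMap q) + Real.cos q.2 * pd2 f (eulerMap q)))
      q.2 := by
  have hE := euler_mem hq
  have hd := (h.diff.differentiableAt ((D2_open κ).mem_nhds hE)).hasFDerivAt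
  have h2 : HasDerivAt (fun s : ℝ => eulerMap (q.1, s))
      (Real.exp q.1 * -Real.sin q.2, Real.exp q.1 * Real.cos q.2) q.2 :=
    ((Real.hasDerivAt_cos q.2).const_mul (Real.exp q.1)).prodMk
      ((Real.hasDerivAt_sin q.2).const_mul (Real.exp q.1))
  have h3 := HasFDerivAt.comp_hasDerivAt (f := fun s : ℝ => eulerMap (q.1, s)) q.2 hd h2
  rw [fderiv_pair, ← pd1_eq (D2_open κ) h.diff hE, ← pd2_eq (D2_open κ) h.diff hE] at h3
  convert! h3 using 1
  push_cast; ring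

abbrev SmT (κ : ℝ) : Type := {u : ℝ × ℝ → ℂ // Sm (D2 κ) u}

def XF (κ a : ℝ) (β : ℕ × ℕ) (u : SmT κ) : ℝ × ℝ → ℂ := fun q =>
  (Real.exp ((a + (β.1 + β.2 : ℝ)) * q.1) : ℂ) * pdMix β u.1 (eulerMap q)

def VF (κ a : ℝ) (β : ℕ × ℕ) (u : SmT κ) : ℝ × ℝ → ℂ := pdMix β (eulerPull a u.1)

lemma XF_zero (κ a : ℝ) (u : SmT κ) : XF κ a (0, 0) u = VF κ a (0, 0) u := by
  funext q
  simp [XF, VF, pdMix, eulerPull]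

lemma XF_sm (κ a : ℝ) (β : ℕ × ℕ) (u : SmT κ) : Sm (strip κ) (XF κ a β u) := by
  refine ContDiffOn.mul ?_ ?_
  · exact (Complex.ofRealCLM.contDiff.comp
      (Real.contDiff_exp.comp (contDiff_const.mul contDiff_fst))).contDiffOn
  · exact ContDiffOn.comp (u.2.mix (D2_open κ) β) contDiff_euler.contDiffOn
      (fun q hq => euler_mem hq)

lemma VF_sm (κ a : ℝ) (β : ℕ × ℕ) (u : SmT κ) : Sm (strip κ) (VF κ a β u) := by
  have h := XF_sm κ a (0, 0) u
  rw [XF_zero] at h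
  exact Sm.mix (f := eulerPull a u.1) (strip_open κ) h β

lemma XF_pd1 (κ a : ℝ) (β : ℕ × ℕ) (u : SmT κ) {q : ℝ × ℝ} (hq : q ∈ strip κ) :
    pd1 (XF κ a β u) q = ((a + (β.1 + β.2 : ℝ) : ℝ) : ℂ) * XF κ a β u q
      + (Real.cos q.2 * XF κ a (β.1 + 1, β.2) u q + Real.sin q.2 * XF κ a (β.1, β.2 + 1) u q) := by
  have h := chain1 (u.2.mix (D2_open κ) β) hq
  rw [pd1_mix, pd2_mix (D2_open κ) u.2 β (euler_mem hq)] at h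
  have he : HasDerivAt (fun s : ℝ => Real.exp ((a + (β.1 + β.2 : ℝ)) * s))
    (Real.exp ((a + (β.1 + β.2 : ℝ)) * q.1) * (a + (β.1 + β.2 : ℝ))) q.1 := by
    simpa using ((hasDerivAt_id q.1).const_mul (a + (β.1 + β.2 : ℝ))).exp
  refine (he.ofReal_comp.mul h).deriv.trans ?_
  simp only [XF]
  have e : Real.exp ((a + (β.1 + β.2 : ℝ)) * q.1) * Real.exp q.1
      = Real.exp ((a + ((β.1 : ℝ) + 1 + β.2)) * q.1) := by rw [← Real.exp_add]; ring_nf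
  have e' : Real.exp ((a + ((β.1 : ℝ) + (β.2 + 1))) * q.1)
      = Real.exp ((a + ((β.1 : ℝ) + 1 + β.2)) * q.1) := by ring_nf
  simp only [Nat.cast_add, Nat.cast_one]
  rw [e', ← e]
  push_cast
  ring

lemma XF_pd2 (κ a : ℝ) (β : ℕ × ℕ) (u : SmT κ) {q : ℝ × ℝ} (hq : q ∈ strip κ) :
    pd2 (XF κ a β u) q =
      (-1) * (Real.sin q.2 * XF κ a (β.1 + 1, β.2) u q) + Real.cos q.2 * XF κ a (β.1, β.2 + 1) u q := by
  have h := chain2 (u.2.mix (D2_open κ) β) hq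
  rw [pd1_mix, pd2_mix (D2_open κ) u.2 β (euler_mem hq)] at h
  refine (h.const_mul ((Real.exp ((a + (β.1 + β.2 : ℝ)) * q.1) : ℝ) : ℂ)).deriv.trans ?_
  simp only [XF]
  have e : Real.exp ((a + (β.1 + β.2 : ℝ)) * q.1) * Real.exp q.1
      = Real.exp ((a + ((β.1 : ℝ) + 1 + β.2)) * q.1) := by rw [← Real.exp_add]; ring_nf
  have e' : Real.exp ((a + ((β.1 : ℝ) + (β.2 + 1))) * q.1)
      = Real.exp ((a + ((β.1 : ℝ) + 1 + β.2)) * q.1) := by ring_nf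
  simp only [Nat.cast_add, Nat.cast_one]
  rw [e', ← e]
  push_cast
  ring

lemma V_in_X (κ a : ℝ) (α : ℕ × ℕ) : Sp (strip κ) (XF κ a) (α.1 + α.2) (VF κ a α) := by
  have hpd : ∀ {m : ℕ} {T : SmT κ → ℝ × ℝ → ℂ}, Sp (strip κ) (XF κ a) m T →
      Sp (strip κ) (XF κ a) (m + 1) (fun i => pd1 (T i)) ∧
      Sp (strip κ) (XF κ a) (m + 1) (fun i => pd2 (T i)) := by
    intro m T h
    refine h.pd (strip_open κ) (XF_sm κ a) (fun β => ?_) (fun β => ?_)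
    · exact .congr _ _ _ (.plus _ _ _ (.smul _ ((a + (β.1 + β.2 : ℝ) : ℝ) : ℂ) _ (.base β _ (by omega)))
        (.plus _ _ _ (.cos _ _ (.base (β.1 + 1, β.2) _ (by simp only; omega)))
          (.sin _ _ (.base (β.1, β.2 + 1) _ (by simp only; omega)))))
        (fun u q hq => XF_pd1 κ a β u hq)
    · exact .congr _ _ _
        (.plus _ _ _ (.smul _ (-1) _ (.sin _ _ (.base (β.1 + 1, β.2) _ (by simp only; omega))))
          (.cos _ _ (.base (β.1, β.2 + 1) _ (by simp only; omega))))
        (fun u q hq => XF_pd2 κ a β u hq)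
  obtain ⟨n, m⟩ := α
  induction n with
  | zero =>
    induction m with
    | zero => exact .congr _ _ _ (.base (0, 0) _ le_rfl) (fun u q _ => by rw [XF_zero])
    | succ m ih =>
      refine .congr _ _ _ ((hpd ih).2.mono (by simp only; omega)) (fun u q _ => ?_)
      simp only [VF, pdMix, Function.iterate_succ_apply', Function.iterate_zero, id]
  | succ n ih =>
    refine .congr _ _ _ ((hpd ih).1.mono (by simp only; omega)) (fun u q _ => ?_)
    simp only [VF, pdMix, Function.iterate_succ_apply']

lemma X_in_V (κ a : ℝ) (α : ℕ × ℕ) : Sp (strip κ) (VF κ a) (α.1 + α.2) (XF κ a α) := by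
  have hpd : ∀ {m : ℕ} {T : SmT κ → ℝ × ℝ → ℂ}, Sp (strip κ) (VF κ a) m T →
      Sp (strip κ) (VF κ a) (m + 1) (fun i => pd1 (T i)) ∧
      Sp (strip κ) (VF κ a) (m + 1) (fun i => pd2 (T i)) := by
    intro m T h
    refine h.pd (strip_open κ) (VF_sm κ a) (fun β => ?_) (fun β => ?_)
    · refine .congr _ _ _ (.base (β.1 + 1, β.2) _ (by simp only; omega)) (fun u q hq => ?_)
      simp only [VF, pd1_mix]
    · refine .congr _ _ _ (.base (β.1, β.2 + 1) _ (by simp only; omega)) (fun u q hq => ?_)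
      exact pd2_mix (strip_open κ) (VF_sm κ a (0, 0) u) β hq
  obtain ⟨n, m⟩ := α
  induction n with
  | zero =>
    induction m with
    | zero => exact .congr _ _ _ (.base (0, 0) _ le_rfl) (fun u q _ => by rw [XF_zero])
    | succ m ih =>
      have hp := hpd ih
      refine Sp.mono (m := 0 + m + 1) (by simp only; omega) (.congr _ _ _ (.plus _ _ _
        (.sin _ _ (.plus _ _ _ hp.1
          (.smul _ (-((a + (((0 : ℕ) : ℝ) + m) : ℝ) : ℂ)) _ (ih.mono (Nat.le_succ _)))))
        (.cos _ _ hp.2)) (fun u q hq => ?_))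
      rw [XF_pd1 κ a (0, m) u hq, XF_pd2 κ a (0, m) u hq]
      have := congrArg (fun x : ℝ => (x : ℂ)) (Real.sin_sq_add_cos_sq q.2)
      push_cast at this ⊢
      linear_combination (- XF κ a (0, m + 1) u q) * this
  | succ n ih =>
    have hp := hpd ih
    refine Sp.mono (m := n + m + 1) (by simp only; omega) (.congr _ _ _ (.plus _ _ _
      (.cos _ _ (.plus _ _ _ hp.1
        (.smul _ (-((a + ((n : ℝ) + m) : ℝ) : ℂ)) _ (ih.mono (Nat.le_succ _)))))
      (.smul _ (-1) _ (.sin _ _ hp.2))) (fun u q hq => ?_))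
    rw [XF_pd1 κ a (n, m) u hq, XF_pd2 κ a (n, m) u hq]
    have := congrArg (fun x : ℝ => (x : ℂ)) (Real.sin_sq_add_cos_sq q.2)
    push_cast at this ⊢
    linear_combination (- XF κ a (n + 1, m) u q) * this

lemma unif {ι : Type} {S : Set (ℝ × ℝ)} {X Y : ℕ × ℕ → ι → ℝ × ℝ → ℂ}
    (h : ∀ α, Sp S X (α.1 + α.2) (Y α)) (k : ℕ) :
    ∃ M : ℝ, 0 ≤ M ∧ ∀ α ∈ idx k, ∀ i, ∀ q ∈ S, ‖Y α i q‖ ≤ M * ∑ β ∈ idx k, ‖X β i q‖ := by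
  have h' : ∀ α, ∃ M : ℝ, 0 ≤ M ∧ (α ∈ idx k → ∀ i, ∀ q ∈ S,
      ‖Y α i q‖ ≤ M * ∑ β ∈ idx k, ‖X β i q‖) := by
    intro α
    by_cases hα : α ∈ idx k
    · obtain ⟨M, h0, h1⟩ := ((h α).mono (mem_idx.1 hα)).bound
      exact ⟨M, h0, fun _ => h1⟩
    · exact ⟨0, le_rfl, fun h => absurd h hα⟩
  choose M h0 h1 using h'
  refine ⟨∑ α ∈ idx k, M α, Finset.sum_nonneg fun α _ => h0 α, fun α hα i q hq => ?_⟩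
  refine (h1 α hα i q hq).trans (mul_le_mul_of_nonneg_right ?_
    (Finset.sum_nonneg fun _ _ => norm_nonneg _))
  exact Finset.single_le_sum (fun α _ => h0 α) hα

lemma lp_cmp {S : Set (ℝ × ℝ)} (hS : MeasurableSet S) {p : ℝ} (hp : 1 < p) (k : ℕ) {M : ℝ}
    (hM : 0 ≤ M) : ∃ C : ℝ, 0 < C ∧ ∀ (f g : ℕ × ℕ → ℝ × ℝ → ℂ) (W : ℝ × ℝ → ℝ),
      (∀ β, ContinuousOn (f β) S) → Measurable W → (∀ q ∈ S, 0 ≤ W q) →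
      (∀ α ∈ idx k, ∀ q ∈ S, ‖g α q‖ ≤ M * ∑ β ∈ idx k, ‖f β q‖) →
      ∑ α ∈ idx k, (∫⁻ q in S, ENNReal.ofReal (‖g α q‖ ^ p * W q)) ^ (1 / p) ≤
        ENNReal.ofReal C *
          ∑ α ∈ idx k, (∫⁻ q in S, ENNReal.ofReal (‖f α q‖ ^ p * W q)) ^ (1 / p) := by
  have hp0 : 0 < p := by linarith
  set N : ℝ := ((idx k).card : ℝ) with hN
  have hN0 : 0 ≤ N := Nat.cast_nonneg _
  set K : ℝ := M ^ p * N ^ (p - 1) with hK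
  have hK0 : 0 ≤ K := by positivity
  refine ⟨N * (K * N) ^ (1 / p) + 1, by positivity, fun f g W hf hW hW0 hg => ?_⟩
  set I : ℕ × ℕ → ℝ≥0∞ := fun α => ∫⁻ q in S, ENNReal.ofReal (‖f α q‖ ^ p * W q) with hI
  set T : ℝ≥0∞ := ∑ α ∈ idx k, I α ^ (1 / p) with hT
  have hmeas : ∀ β ∈ idx k, AEMeasurable (fun q => ENNReal.ofReal (‖f β q‖ ^ p * W q))
      (volume.restrict S) := by
    intro β _
    have h1 : AEMeasurable (f β) (volume.restrict S) := (hf β).aemeasurable hS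
    exact ((h1.norm.pow_const p).mul hW.aemeasurable).ennreal_ofReal
  have hIT : ∀ β ∈ idx k, I β ≤ T ^ p := by
    intro β hβ
    have h1 : I β ^ (1 / p) ≤ T :=
      Finset.single_le_sum (f := fun α => I α ^ (1 / p)) (fun _ _ => zero_le) hβ
    calc I β = (I β ^ (1 / p)) ^ p := by
          rw [← ENNReal.rpow_mul, one_div_mul_cancel hp0.ne', ENNReal.rpow_one]
      _ ≤ T ^ p := ENNReal.rpow_le_rpow h1 hp0.le
  have hone : ∀ α ∈ idx k, (∫⁻ q in S, ENNReal.ofReal (‖g α q‖ ^ p * W q)) ^ (1 / p) ≤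
      ENNReal.ofReal ((K * N) ^ (1 / p)) * T := by
    intro α hα
    have h1 : ∫⁻ q in S, ENNReal.ofReal (‖g α q‖ ^ p * W q) ≤
        ∫⁻ q in S, ENNReal.ofReal K * ∑ β ∈ idx k, ENNReal.ofReal (‖f β q‖ ^ p * W q) := by
      refine setLIntegral_mono' hS fun q hq => ?_
      rw [← ENNReal.ofReal_sum_of_nonneg (fun β _ => mul_nonneg (by positivity) (hW0 q hq)),
        ← ENNReal.ofReal_mul hK0]
      apply ENNReal.ofReal_le_ofReal
      rw [← Finset.sum_mul, ← mul_assoc]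
      refine mul_le_mul_of_nonneg_right ?_ (hW0 q hq)
      calc ‖g α q‖ ^ p ≤ (M * ∑ β ∈ idx k, ‖f β q‖) ^ p :=
            Real.rpow_le_rpow (norm_nonneg _) (hg α hα q hq) hp0.le
        _ = M ^ p * (∑ β ∈ idx k, ‖f β q‖) ^ p :=
            Real.mul_rpow hM (Finset.sum_nonneg fun _ _ => norm_nonneg _)
        _ ≤ M ^ p * (N ^ (p - 1) * ∑ β ∈ idx k, ‖f β q‖ ^ p) :=
            mul_le_mul_of_nonneg_left (Real.rpow_sum_le_const_mul_sum_rpow_of_nonneg _ hp.le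
              fun _ _ => norm_nonneg _) (by positivity)
        _ = K * ∑ β ∈ idx k, ‖f β q‖ ^ p := by rw [hK]; ring
    have h2 : ∫⁻ q in S, ENNReal.ofReal (‖g α q‖ ^ p * W q) ≤ ENNReal.ofReal (K * N) * T ^ p := by
      refine h1.trans ?_
      rw [lintegral_const_mul' _ _ ENNReal.ofReal_ne_top, lintegral_finsetSum' _ hmeas,
        ENNReal.ofReal_mul hK0, mul_assoc]
      gcongr
      refine (Finset.sum_le_sum hIT).trans ?_
      rw [Finset.sum_const, nsmul_eq_mul, hN, ENNReal.ofReal_natCast]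
    refine (ENNReal.rpow_le_rpow h2 (by positivity)).trans ?_
    rw [ENNReal.mul_rpow_of_nonneg _ _ (by positivity), ← ENNReal.rpow_mul,
      mul_one_div_cancel hp0.ne', ENNReal.rpow_one,
      ENNReal.ofReal_rpow_of_nonneg (by positivity) (by positivity)]
  refine (Finset.sum_le_sum hone).trans ?_
  rw [Finset.sum_const, nsmul_eq_mul, ← mul_assoc, ← ENNReal.ofReal_natCast,
    ← ENNReal.ofReal_mul hN0]
  gcongr
  linarith

lemma sum_cmp {k : ℕ} {p L : ℝ} (hp : 1 < p) (hL : 0 ≤ L) {I J : ℕ × ℕ → ℝ≥0∞}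
    (h : ∀ α, I α ≤ ENNReal.ofReal L * J α) :
    ∑ α ∈ idx k, I α ^ (1 / p) ≤ ENNReal.ofReal (L ^ (1 / p)) * ∑ α ∈ idx k, J α ^ (1 / p) := by
  have : 0 ≤ 1 / p := by have : 0 < p := by linarith
                         positivity
  rw [Finset.mul_sum]
  refine Finset.sum_le_sum fun α _ => (ENNReal.rpow_le_rpow (h α) this).trans ?_
  rw [ENNReal.mul_rpow_of_nonneg _ _ this, ENNReal.ofReal_rpow_of_nonneg hL this]

lemma pull_int {κ : ℝ} (hκ : 0 < κ) (hκ' : κ < 2 * π) (p γ ν a : ℝ) (hp : 1 < p) (k : ℕ)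
    (u : SmT κ) (α : ℕ × ℕ) :
    ∫⁻ x in D2 κ, ENNReal.ofReal (‖pdMix α u.1 x‖ ^ p *
        wgt2 κ γ (ν + ((α.1 + α.2 : ℝ) - k) * p) x) =
      ∫⁻ q in strip κ, ENNReal.ofReal (‖XF κ a α u q‖ ^ p *
        (Real.exp ((ν + 2 - ((k : ℝ) + a) * p) * q.1) *
          (rhoD2 κ (eulerMap q) / Real.exp q.1) ^ γ)) := by
  have hset : ∀ F : ℝ × ℝ → ℝ≥0∞, ∫⁻ x in D2 κ, F x = ∫⁻ x in eulerMap '' strip κ, F x := by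
    intro F; rw [← D2_eq]
  rw [hset, lintegral_image_eq_lintegral_abs_det_fderiv_mul volume (strip_open κ).measurableSet
    (fun q _ => (hasFDerivAt_euler q).hasFDerivWithinAt) (euler_inj hκ')]
  refine setLIntegral_congr_fun (strip_open κ).measurableSet fun q hq => ?_
  rw [← ENNReal.ofReal_mul (abs_nonneg _), det_eulerD, abs_of_pos (by positivity), wgt2,
    enorm2_euler]
  congr 1
  have hR := Real.exp_pos q.1
  have hρ : 0 ≤ rhoD2 κ (eulerMap q) := by
    refine le_trans ?_ (rho_bounds hκ hκ' hq).1
    have : 0 ≤ min q.2 (κ - q.2) := le_min hq.1.le (by linarith [hq.2])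
    positivity
  rw [XF, norm_mul, Complex.norm_real, Real.norm_eq_abs, abs_of_pos (Real.exp_pos _),
    Real.mul_rpow (Real.exp_pos _).le (norm_nonneg _), Real.div_rpow hρ hR.le,
    ← Real.exp_mul, ← Real.exp_mul, ← Real.exp_mul, div_eq_mul_inv, ← Real.exp_neg]
  have key : Real.exp q.1 * Real.exp q.1 *
        Real.exp (q.1 * (ν + ((α.1 + α.2 : ℝ) - k) * p - γ)) =
      Real.exp ((a + (α.1 + α.2 : ℝ)) * q.1 * p) * Real.exp ((ν + 2 - ((k : ℝ) + a) * p) * q.1) *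
        Real.exp (-(q.1 * γ)) := by
    rw [← Real.exp_add, ← Real.exp_add, ← Real.exp_add, ← Real.exp_add]
    congr 1
    ring
  linear_combination (‖pdMix α u.1 (eulerMap q)‖ ^ p * rhoD2 κ (eulerMap q) ^ γ) * key

lemma t_cmp {κ : ℝ} (hκ : 0 < κ) (hκ' : κ < 2 * π) (γ : ℝ) {q : ℝ × ℝ} (hq : q ∈ strip κ) :
    (rhoD2 κ (eulerMap q) / Real.exp q.1) ^ γ ≤ π ^ |γ| * min q.2 (κ - q.2) ^ γ ∧
    min q.2 (κ - q.2) ^ γ ≤ π ^ |γ| * (rhoD2 κ (eulerMap q) / Real.exp q.1) ^ γ := by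
  have hR := Real.exp_pos q.1
  obtain ⟨h1, h2⟩ := rho_bounds hκ hκ' hq
  refine rpow_cmp γ (lt_min hq.1 (by linarith [hq.2])) ?_ ?_
  · rw [le_div_iff₀ hR]; refine le_trans (le_of_eq ?_) h1; ring
  · rw [div_le_iff₀ hR]; linarith

lemma lint_cmp {S : Set (ℝ × ℝ)} (hS : MeasurableSet S) {L : ℝ} (hL : 0 ≤ L)
    {A B s t : ℝ × ℝ → ℝ} (hA : ∀ q, 0 ≤ A q) (hB : ∀ q, 0 ≤ B q) (h : ∀ q ∈ S, s q ≤ L * t q) :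
    ∫⁻ q in S, ENNReal.ofReal (A q * (B q * s q)) ≤
      ENNReal.ofReal L * ∫⁻ q in S, ENNReal.ofReal (A q * (B q * t q)) := by
  rw [← lintegral_const_mul' _ _ ENNReal.ofReal_ne_top]
  refine setLIntegral_mono' hS fun q hq => ?_
  rw [← ENNReal.ofReal_mul hL]
  apply ENNReal.ofReal_le_ofReal
  calc A q * (B q * s q) ≤ A q * (B q * (L * t q)) :=
        mul_le_mul_of_nonneg_left (mul_le_mul_of_nonneg_left (h q hq) (hB q)) (hA q)
    _ = _ := by ring

theorem stmt12 (κ : ℝ) (hκ : 0 < κ) (hκ' : κ < 2 * π)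
    (p γ ν a : ℝ) (hp : 1 < p) (k : ℕ) :
    ∃ c C : ℝ, 0 < c ∧ c ≤ C ∧
      ∀ u : ℝ × ℝ → ℂ, ContDiffOn ℝ (⊤ : ℕ∞) u (D2 κ) →
        ENNReal.ofReal c *
            ∑ α ∈ idx k,
              (∫⁻ q in strip κ, ENNReal.ofReal
                (‖pdMix α (eulerPull a u) q‖ ^ p *
                  (Real.exp ((ν + 2 - ((k : ℝ) + a) * p) * q.1) *
                    min q.2 (κ - q.2) ^ γ))) ^ (1 / p)
          ≤ ∑ α ∈ idx k,
              (∫⁻ x in D2 κ, ENNReal.ofReal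
                (‖pdMix α u x‖ ^ p *
                  wgt2 κ γ (ν + ((α.1 + α.2 : ℝ) - k) * p) x)) ^ (1 / p) ∧
        ∑ α ∈ idx k,
            (∫⁻ x in D2 κ, ENNReal.ofReal
              (‖pdMix α u x‖ ^ p *
                wgt2 κ γ (ν + ((α.1 + α.2 : ℝ) - k) * p) x)) ^ (1 / p)
          ≤ ENNReal.ofReal C *
              ∑ α ∈ idx k,
                (∫⁻ q in strip κ, ENNReal.ofReal
                  (‖pdMix α (eulerPull a u) q‖ ^ p *
                    (Real.exp ((ν + 2 - ((k : ℝ) + a) * p) * q.1) *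
                      min q.2 (κ - q.2) ^ γ))) ^ (1 / p) := by
  have hS := (strip_open κ).measurableSet
  obtain ⟨M₁, hM₁, b₁⟩ := unif (V_in_X κ a) k
  obtain ⟨M₂, hM₂, b₂⟩ := unif (X_in_V κ a) k
  obtain ⟨C₁, hC₁, c₁⟩ := lp_cmp hS hp k hM₁
  obtain ⟨C₂, hC₂, c₂⟩ := lp_cmp hS hp k hM₂
  set L : ℝ := π ^ |γ| with hLdef
  have hL : 0 < L := Real.rpow_pos_of_pos Real.pi_pos _
  set L' : ℝ := L ^ (1 / p) with hL'def
  have hL' : 0 < L' := Real.rpow_pos_of_pos hL _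
  refine ⟨(C₁ * L')⁻¹, max (C₁ * L')⁻¹ (L' * C₂), by positivity, le_max_left _ _, ?_⟩
  intro u hu
  set W : ℝ × ℝ → ℝ := fun q => Real.exp ((ν + 2 - ((k : ℝ) + a) * p) * q.1) *
    min q.2 (κ - q.2) ^ γ with hW
  have hWm : Measurable W := by fun_prop
  have hW0 : ∀ q ∈ strip κ, 0 ≤ W q := fun q hq =>
    mul_nonneg (Real.exp_pos _).le
      (Real.rpow_nonneg (le_min hq.1.le (by linarith [hq.2])) _)
  have d₁ := c₁ (fun β => XF κ a β ⟨u, hu⟩) (fun β => VF κ a β ⟨u, hu⟩) W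
    (fun β => (XF_sm κ a β ⟨u, hu⟩).continuousOn) hWm hW0 (fun α hα q hq => b₁ α hα ⟨u, hu⟩ q hq)
  have d₂ := c₂ (fun β => VF κ a β ⟨u, hu⟩) (fun β => XF κ a β ⟨u, hu⟩) W
    (fun β => (VF_sm κ a β ⟨u, hu⟩).continuousOn) hWm hW0 (fun α hα q hq => b₂ α hα ⟨u, hu⟩ q hq)
  have e₁ := sum_cmp (k := k) hp hL.le
    (I := fun α => ∫⁻ q in strip κ, ENNReal.ofReal (‖XF κ a α ⟨u, hu⟩ q‖ ^ p * W q))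
    (J := fun α => ∫⁻ x in D2 κ, ENNReal.ofReal (‖pdMix α u x‖ ^ p *
        wgt2 κ γ (ν + ((α.1 + α.2 : ℝ) - k) * p) x))
    (fun α => by
      rw [pull_int hκ hκ' p γ ν a hp k ⟨u, hu⟩ α]
      exact lint_cmp hS hL.le (fun q => by positivity) (fun q => by positivity)
        (fun q hq => (t_cmp hκ hκ' γ hq).2))
  have e₂ := sum_cmp (k := k) hp hL.le
    (J := fun α => ∫⁻ q in strip κ, ENNReal.ofReal (‖XF κ a α ⟨u, hu⟩ q‖ ^ p * W q))
    (I := fun α => ∫⁻ x in D2 κ, ENNReal.ofReal (‖pdMix α u x‖ ^ p *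
        wgt2 κ γ (ν + ((α.1 + α.2 : ℝ) - k) * p) x))
    (fun α => by
      rw [pull_int hκ hκ' p γ ν a hp k ⟨u, hu⟩ α]
      exact lint_cmp hS hL.le (fun q => by positivity) (fun q => by positivity)
        (fun q hq => (t_cmp hκ hκ' γ hq).1))
  constructor
  · have h := d₁.trans (mul_le_mul_right e₁ _)
    rw [← mul_assoc, ← ENNReal.ofReal_mul hC₁.le] at h
    refine (mul_le_mul_right h (ENNReal.ofReal (C₁ * L')⁻¹)).trans ?_
    rw [← mul_assoc, ← ENNReal.ofReal_mul (by positivity), inv_mul_cancel₀ (by positivity),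
      ENNReal.ofReal_one, one_mul]
  · have h := e₂.trans (mul_le_mul_right d₂ _)
    rw [← mul_assoc, ← ENNReal.ofReal_mul hL'.le] at h
    exact h.trans (mul_le_mul_left (ENNReal.ofReal_le_ofReal (le_max_right _ _)) _)
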